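/- arXiv:1711.08554 — 2 statements merged into one kernel-verified Lean document; each statement's English description precedes it below -/
import Mathlib

section
/- For every infinite cardinal κ, ded(κ) equals the supremum of the cardinals λ such that there exists a chain of subsets of a set of cardinality κ (totally ordered by inclusion) of cardinality λ. -/
universe u
open Cardinal

noncomputable def ded (κ : Cardinal.{u}) : Cardinal.{u} :=
  sSup {lam : Cardinal.{u} | ∃ (B : Type u) (_ : LinearOrder B) (D : Set B),
    #B = lam ∧ #D = κ ∧ ∀ x y : B, x < y → ∃ d ∈ D, x < d ∧ d < y}

/-- If `E` is weakly dense in the linear order `L` above the points of `S`, then replacing every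
point of `E` by a copy of a dense order without endpoints yields a dense set. -/
theorem exists_dense_of_weakly_dense {L Q : Type u} [LinearOrder L] [LinearOrder Q]
    [DenselyOrdered Q] [NoMinOrder Q] [NoMaxOrder Q] [Nonempty Q] (S E : Set L)
    (hSE : ∀ x ∈ S, ∀ y ∈ S, x < y → ∃ e ∈ E, x ≤ e ∧ e ≤ y) :
    ∃ (B : Type u) (_ : LinearOrder B) (D : Set B),
      #S ≤ #B ∧ #D = #E * #Q ∧ ∀ x y : B, x < y → ∃ d ∈ D, x < d ∧ d < y := by
  obtain ⟨q₀⟩ := ‹Nonempty Q›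
  let P : Set (L ×ₗ Q) :=
    {p | (ofLex p).1 ∈ E ∨ ((ofLex p).1 ∈ S ∧ (ofLex p).2 = q₀)}
  have hlt (p r : P) : p < r ↔ (ofLex p.1).1 < (ofLex r.1).1 ∨
      (ofLex p.1).1 = (ofLex r.1).1 ∧ (ofLex p.1).2 < (ofLex r.1).2 :=
    Prod.Lex.lt_iff
  refine ⟨P, inferInstance, {p | (ofLex p.1).1 ∈ E}, ?_, ?_, ?_⟩
  · refine mk_le_of_injective
      (f := fun x : S ↦ (⟨toLex (x.1, q₀), Or.inr ⟨x.2, rfl⟩⟩ : P)) fun x y h ↦ ?_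
    exact Subtype.ext (congrArg (fun p : P ↦ (ofLex p.1).1) h)
  · rw [mul_def]
    exact mk_congr
      { toFun := fun p ↦ (⟨(ofLex p.1.1).1, p.2⟩, (ofLex p.1.1).2)
        invFun := fun p ↦ ⟨⟨toLex (p.1.1, p.2), Or.inl p.1.2⟩, p.1.2⟩
        left_inv := fun _ ↦ rfl
        right_inv := fun _ ↦ rfl }
  · rintro ⟨⟨x, q⟩, hx⟩ ⟨⟨y, r⟩, hy⟩ h
    rw [hlt] at h
    change x < y ∨ x = y ∧ q < r at h
    change x ∈ E ∨ (x ∈ S ∧ q = q₀) at hx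
    change y ∈ E ∨ (y ∈ S ∧ r = q₀) at hy
    have key : ∃ e : L, ∃ s : Q, e ∈ E ∧
        (x < e ∨ x = e ∧ q < s) ∧ (e < y ∨ e = y ∧ s < r) := by
      rcases h with h | ⟨rfl, h⟩
      · have he : ∃ e ∈ E, x ≤ e ∧ e ≤ y := by
          rcases hx with hx | hx
          · exact ⟨x, hx, le_rfl, h.le⟩
          rcases hy with hy | hy
          · exact ⟨y, hy, h.le, le_rfl⟩
          exact hSE x hx.1 y hy.1 h
        obtain ⟨e, he, hxe, hey⟩ := he
        rcases hxe.eq_or_lt with rfl | hxe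
        · obtain ⟨s, hs⟩ := exists_gt q
          exact ⟨x, s, he, Or.inr ⟨rfl, hs⟩, Or.inl h⟩
        rcases hey.eq_or_lt with rfl | hey
        · obtain ⟨s, hs⟩ := exists_lt r
          exact ⟨e, s, he, Or.inl hxe, Or.inr ⟨rfl, hs⟩⟩
        exact ⟨e, q₀, he, Or.inl hxe, Or.inl hey⟩
      · have hxE : x ∈ E := by
          rcases hx with hx | hx
          · exact hx
          rcases hy with hy | hy
          · exact hy
          exact absurd h (by rw [hx.2, hy.2]; exact lt_irrefl _)
        obtain ⟨s, hqs, hsr⟩ := exists_between h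
        exact ⟨x, s, hxE, Or.inr ⟨rfl, hqs⟩, Or.inr ⟨rfl, hsr⟩⟩
    obtain ⟨e, s, he, hl, hr⟩ := key
    exact ⟨⟨toLex (e, s), Or.inl he⟩, he, (hlt _ _).2 hl, (hlt _ _).2 hr⟩

/-- Every infinite cardinal is the cardinality of a dense linear order without endpoints. -/
theorem exists_denselyOrdered_mk_eq (κ : Cardinal.{u}) (hκ : ℵ₀ ≤ κ) :
    ∃ (Q : Type u) (_ : LinearOrder Q),
      DenselyOrdered Q ∧ NoMinOrder Q ∧ NoMaxOrder Q ∧ #Q = κ := by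
  refine ⟨κ.ord.ToType ×ₗ ℚ, inferInstance, inferInstance, inferInstance, inferInstance, ?_⟩
  rw [mk_congr ofLex, mk_prod]
  simpa using mul_aleph0_eq hκ

theorem exists_dense_of_isChain {T : Type u} {C : Set (Set T)} (hT : ℵ₀ ≤ #T)
    (hC : IsChain (· ⊆ ·) C) :
    ∃ (B : Type u) (_ : LinearOrder B) (D : Set B),
      #C ≤ #B ∧ #D = #T ∧ ∀ x y : B, x < y → ∃ d ∈ D, x < d ∧ d < y := by
  classical
  obtain ⟨Q, _, _, _, _, hQ⟩ := exists_denselyOrdered_mk_eq #T hT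
  have : Infinite T := infinite_iff.2 hT
  have : Nonempty Q := mk_ne_zero_iff.1 (hQ ▸ (aleph0_pos.trans_le hT).ne')
  let _ : LinearOrder C :=
    { (inferInstance : PartialOrder C) with
      le_total := fun A B ↦ hC.total A.2 B.2
      toDecidableLE := Classical.decRel _ }
  let cut (t : T) : LowerSet C := ⟨{A | t ∉ A.1}, fun _ _ hBA hA hB ↦ hA (hBA hB)⟩
  obtain ⟨B, _, D, hB, hD, hBD⟩ := exists_dense_of_weakly_dense (Q := Q)
    (Set.range (LowerSet.Iic : C → LowerSet C)) (Set.range cut) (by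
      rintro _ ⟨x, rfl⟩ _ ⟨y, rfl⟩ h
      obtain ⟨t, hty, htx⟩ := Set.not_subset.1 ((LowerSet.Iic_strictMono C).lt_iff_lt.1 h).not_ge
      refine ⟨cut t, ⟨t, rfl⟩, fun A hA ht ↦ htx (hA ht), fun A hA ↦ ?_⟩
      exact (le_total A y).resolve_right fun hyA ↦ hA (hyA hty))
  refine ⟨B, _, D, ?_, ?_, hBD⟩
  · rwa [mk_range_eq _ (LowerSet.Iic_strictMono C).injective] at hB
  · rw [hD, hQ]
    exact mul_eq_right hT mk_range_le (mk_ne_zero _)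

theorem exists_isChain_of_dense {B : Type u} [LinearOrder B] (D : Set B)
    (hD : ∀ x y : B, x < y → ∃ d ∈ D, x < d ∧ d < y) :
    ∃ C : Set (Set D), IsChain (· ⊆ ·) C ∧ #C = #B := by
  let f (b : B) : Set D := {d | d.1 < b}
  have hf : StrictMono f := fun x y h ↦ by
    obtain ⟨d, hd, hxd, hdy⟩ := hD x y h
    exact Set.ssubset_iff_subset_ne.2 ⟨fun _ ha ↦ lt_trans ha h,
      fun he ↦ hxd.not_gt ((Set.ext_iff.1 he ⟨d, hd⟩).2 hdy)⟩
  exact ⟨Set.range f, hf.monotone.isChain_range, mk_range_eq f hf.injective⟩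

/-- For every infinite cardinal `κ`, `ded κ` (the supremum of cardinalities
of linear orders having a dense subset of cardinality `κ`) equals the supremum of the
cardinalities of chains of subsets of a set of cardinality `κ`. -/
theorem stmt10 (κ : Cardinal.{u}) (hκ : ℵ₀ ≤ κ) :
    ded κ = sSup {lam : Cardinal.{u} |
      ∃ (T : Type u) (C : Set (Set T)), #T = κ ∧ IsChain (· ⊆ ·) C ∧ #C = lam} := by
  have hbdd : BddAbove {lam : Cardinal.{u} |
      ∃ (T : Type u) (C : Set (Set T)), #T = κ ∧ IsChain (· ⊆ ·) C ∧ #C = lam} := by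
    refine ⟨2 ^ κ, ?_⟩
    rintro _ ⟨T, C, rfl, -, rfl⟩
    exact (mk_set_le C).trans_eq (mk_set (α := T))
  have hsub : {lam : Cardinal.{u} | ∃ (B : Type u) (_ : LinearOrder B) (D : Set B),
      #B = lam ∧ #D = κ ∧ ∀ x y : B, x < y → ∃ d ∈ D, x < d ∧ d < y} ⊆
      {lam : Cardinal.{u} |
        ∃ (T : Type u) (C : Set (Set T)), #T = κ ∧ IsChain (· ⊆ ·) C ∧ #C = lam} := by
    rintro _ ⟨B, _, D, rfl, hDκ, hD⟩
    obtain ⟨C, hC, hCB⟩ := exists_isChain_of_dense D hD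
    exact ⟨D, C, hDκ, hC, hCB⟩
  refine le_antisymm (csSup_le_csSup' hbdd hsub) (csSup_le' ?_)
  rintro _ ⟨T, C, rfl, hC, rfl⟩
  obtain ⟨B, _, D, hCB, hDT, hD⟩ := exists_dense_of_isChain hκ hC
  exact hCB.trans (le_csSup (hbdd.mono hsub) ⟨B, _, D, rfl, hDT, hD⟩)
end

section
/- Let κ be a pseudo strong limit (PSL) cardinal with κ > ℵ₀, and let S be a commutative integral domain of cardinality κ. Then there exist commutative rings R and T with R a subring of S and S a subring of T, such that |R| = |T| = κ and both R and T possess a chain of prime ideals of cardinality 2^κ (so both have strong cardinal Krull dimension 2^κ). -/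
universe u
open Cardinal

noncomputable def chainLen {X : Type u} (C : Set X) : Cardinal.{u} := by
  classical exact if h : C.Finite then ((h.toFinset.card - 1 : ℕ) : Cardinal.{u}) else #C

def IsPrimeIdealChain {R : Type u} [Ring R] (C : Set (Ideal R)) : Prop :=
  (∀ P ∈ C, P.IsPrime) ∧ IsChain (· ≤ ·) C

noncomputable def cKrullDim (R : Type u) [Ring R] : Cardinal.{u} :=
  ⨆ C : {C : Set (Ideal R) // C.Nonempty ∧ IsPrimeIdealChain C}, chainLen C.1

def HasStrongCDim (R : Type u) [Ring R] (lam : Cardinal.{u}) : Prop :=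
  cKrullDim R = lam ∧
    ∃ C : Set (Ideal R), C.Nonempty ∧ IsPrimeIdealChain C ∧ chainLen C = lam
/-- Under the pseudo strong limit condition, an infinite set has a chain of `2 ^ κ` subsets: the
down-sets, in the lexicographic order on binary `κ`-sequences, of sequences of bounded support. -/
theorem exists_strictMono_set_of_psl {κ : Cardinal.{u}} (hκ : ℵ₀ ≤ κ)
    (hpsl : ∀ α : Cardinal.{u}, α < κ → 2 ^ α ≤ κ) {σ : Type u} (hσ : #σ = κ) :
    ∃ (L : Type u) (_ : LinearOrder L) (D : L → Set σ), StrictMono D ∧ #L = 2 ^ κ := by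
  classical
  let I := κ.ord.ToType
  have hI : #I = κ := mk_ord_toType κ
  let N : I → Set (Lex (I → Bool)) := fun i ↦ {g | ∀ j, i < j → g j = false}
  have hN (i : I) : #(N i) ≤ κ := by
    have h1 : #(Set.Iic i) < κ := by
      have h := mk_Iic_lt i (by rw [hI]; simp [I]) (by rw [hI]; exact hκ)
      rwa [hI] at h
    refine le_trans ?_ (hpsl _ h1)
    rw [← mk_set]
    refine mk_le_of_injective (f := fun g : N i ↦ {j : Set.Iic i | g.1 j.1 = true}) ?_
    intro g g' h
    apply Subtype.ext
    funext j
    by_cases hj : j ≤ i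
    · exact Bool.eq_iff_iff.2 (Set.ext_iff.1 h ⟨j, hj⟩)
    · rw [g.2 j (not_le.1 hj), g'.2 j (not_le.1 hj)]
  have hU : #(⋃ i, N i) ≤ #σ := by
    rw [hσ]
    refine (mk_iUnion_le _).trans ?_
    calc #I * ⨆ i, #(N i) ≤ κ * κ := mul_le_mul' hI.le (ciSup_le' hN)
      _ = κ := mul_eq_self hκ
  obtain ⟨e⟩ := hU
  refine ⟨Lex (I → Bool), inferInstance, fun f ↦ e '' {g | g.1 ≤ f}, ?_, ?_⟩
  · intro f f' hlt
    refine ⟨Set.image_mono fun g hg ↦ le_trans hg hlt.le, fun hsub ↦ ?_⟩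
    rw [Set.image_subset_image_iff e.injective] at hsub
    obtain ⟨i, hi, hfi⟩ := id hlt
    let g : Lex (I → Bool) := toLex fun j ↦ if j ≤ i then f' j else false
    have hgN : g ∈ ⋃ i, N i := Set.mem_iUnion.2 ⟨i, fun j hj ↦ by simp [g, not_le.2 hj]⟩
    have hgle : g ≤ f' := by
      refine Pi.toLex_monotone (a := fun j ↦ if j ≤ i then f' j else false) (b := f') fun j ↦ ?_
      dsimp only
      split_ifs
      · exact le_rfl
      · exact bot_le
    have hfg : f < g := by
      refine ⟨i, fun j hj ↦ ?_, ?_⟩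
      · simpa [g, le_of_lt hj] using hi j hj
      · simpa [g] using hfi
    exact absurd (hsub (a := ⟨g, hgN⟩) hgle) (not_le.2 hfg)
  · change #(I → Bool) = _
    simp [I]

/-- The kernel of the substitution `X i ↦ 0` for `i ∈ s`. -/
noncomputable def varIdeal {σ A : Type u} [CommRing A] (s : Set σ) : Ideal (MvPolynomial σ A) :=
  RingHom.ker (MvPolynomial.aeval (R := A) (sᶜ.indicator (MvPolynomial.X (R := A))))

theorem varIdeal_isPrime {σ A : Type u} [CommRing A] [IsDomain A] (s : Set σ) :
    (varIdeal (A := A) s).IsPrime :=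
  RingHom.ker_isPrime _

theorem X_mem_varIdeal {σ A : Type u} [CommRing A] [Nontrivial A] (s : Set σ) (i : σ) :
    MvPolynomial.X i ∈ varIdeal (A := A) s ↔ i ∈ s := by
  rw [varIdeal, RingHom.mem_ker, MvPolynomial.aeval_X, Set.indicator_apply_eq_zero]
  simp [MvPolynomial.X_ne_zero]

theorem varIdeal_mono {σ A : Type u} [CommRing A] : Monotone (varIdeal (σ := σ) (A := A)) := by
  intro s t hst p hp
  rw [varIdeal, RingHom.mem_ker] at hp ⊢
  have key : (MvPolynomial.aeval (R := A) (tᶜ.indicator (MvPolynomial.X (R := A)))).comp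
      (MvPolynomial.aeval (R := A) (sᶜ.indicator (MvPolynomial.X (R := A)))) =
      MvPolynomial.aeval (R := A) (tᶜ.indicator (MvPolynomial.X (R := A))) := by
    refine MvPolynomial.algHom_ext fun i ↦ ?_
    by_cases hs : i ∈ s
    · simp [hs, hst hs]
    · simp [hs]
  rw [← key, AlgHom.comp_apply, hp, map_zero]

theorem varIdeal_injective {σ A : Type u} [CommRing A] [Nontrivial A] :
    Function.Injective (varIdeal (σ := σ) (A := A)) := fun s t h ↦ by
  ext i
  rw [← X_mem_varIdeal (A := A) s, h, X_mem_varIdeal]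

/-- A ring isomorphic to a polynomial ring in `κ` variables over a domain has a chain of `2 ^ κ`
prime ideals when `κ` is a pseudo strong limit. -/
theorem exists_primeIdealChain_of_equiv {κ : Cardinal.{u}} (hκ : ℵ₀ ≤ κ)
    (hpsl : ∀ α : Cardinal.{u}, α < κ → 2 ^ α ≤ κ) {σ A B : Type u} [CommRing A] [IsDomain A]
    [CommRing B] (hσ : #σ = κ) (e : B ≃+* MvPolynomial σ A) :
    ∃ C : Set (Ideal B), IsPrimeIdealChain C ∧ #C = 2 ^ κ := by
  obtain ⟨L, _, D, hD, hL⟩ := exists_strictMono_set_of_psl hκ hpsl hσ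
  let F : L → Ideal B := fun l ↦ (varIdeal (A := A) (D l)).comap e
  have hmono : Monotone F := fun _ _ h ↦ Ideal.comap_mono (varIdeal_mono (hD.monotone h))
  have hinj : Function.Injective F := fun _ _ h ↦
    hD.injective (varIdeal_injective (Ideal.comap_injective_of_surjective e e.surjective h))
  refine ⟨Set.range F, ⟨?_, hmono.isChain_range⟩, by rw [mk_range_eq F hinj, hL]⟩
  rintro _ ⟨l, rfl⟩
  have := varIdeal_isPrime (A := A) (D l)
  exact Ideal.comap_isPrime _ _

theorem chainLen_le {X : Type u} (C : Set X) : chainLen C ≤ #C := by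
  unfold chainLen
  split_ifs with h
  · calc ((h.toFinset.card - 1 : ℕ) : Cardinal) ≤ (h.toFinset.card : ℕ) :=
          Nat.cast_le.2 (Nat.sub_le _ _)
      _ = #C := by rw [← mk_coe_finset]; simp
  · exact le_rfl

theorem chainLen_of_infinite {X : Type u} {C : Set X} (hC : C.Infinite) : chainLen C = #C :=
  dif_neg hC

/-- A ring of infinite cardinality `κ` with a prime ideal chain of cardinality `2 ^ κ` has strong
cardinal Krull dimension `2 ^ κ`. -/
theorem hasStrongCDim_of_chain {κ : Cardinal.{u}} (hκ : ℵ₀ ≤ κ) {B : Type u} [CommRing B]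
    (hB : #B = κ) (h : ∃ C : Set (Ideal B), IsPrimeIdealChain C ∧ #C = 2 ^ κ) :
    HasStrongCDim B (2 ^ κ) := by
  obtain ⟨C, hC, hcard⟩ := h
  have hinf : C.Infinite := by
    rw [← Set.infinite_coe_iff, infinite_iff, hcard]
    exact hκ.trans (cantor κ).le
  have hlen : chainLen C = 2 ^ κ := (chainLen_of_infinite hinf).trans hcard
  have hle (C' : Set (Ideal B)) : chainLen C' ≤ 2 ^ κ := by
    refine (chainLen_le C').trans ((mk_set_le C').trans ?_)
    rw [← hB, ← mk_set]
    exact mk_le_of_injective SetLike.coe_injective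
  refine ⟨le_antisymm (ciSup_le' fun C' ↦ hle C'.1) ?_, C, hinf.nonempty, hC, hlen⟩
  rw [← hlen]
  exact le_ciSup (f := fun C : {C : Set (Ideal B) // C.Nonempty ∧ IsPrimeIdealChain C} ↦
    chainLen C.1) ⟨2 ^ κ, by rintro _ ⟨C', rfl⟩; exact hle C'.1⟩ ⟨C, hinf.nonempty, hC⟩

/-- An uncountable domain contains a polynomial ring over a domain with as many variables as the
domain has elements. -/
theorem exists_subring_equiv_mvPolynomial (S : Type u) [CommRing S] [IsDomain S] (hS : ℵ₀ < #S) :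
    ∃ (R : Subring S) (A σ : Type u) (_ : CommRing A) (_ : IsDomain A),
      #σ = #S ∧ Nonempty (R ≃+* MvPolynomial σ A) := by
  let A : Subring S := (Int.castRingHom S).range
  have hA : #A ≤ ℵ₀ := by
    have : Countable A := (Int.castRingHom S).rangeRestrict_surjective.countable
    exact mk_le_aleph0
  obtain ⟨s, hs⟩ := exists_isTranscendenceBasis A S
  have := hs.isAlgebraic
  have h1 := Algebra.IsAlgebraic.cardinalMk_le_max
    (Algebra.adjoin A (Set.range ((↑) : s → S))) S
  have h2 := Algebra.cardinalMk_adjoin_le A (Set.range ((↑) : s → S))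
  rw [Subtype.range_coe] at h1 h2
  refine ⟨(Algebra.adjoin A (Set.range ((↑) : s → S))).toSubring, A, s, inferInstance,
    inferInstance, (mk_set_le s).antisymm ?_, ⟨hs.1.aevalEquiv.symm.toRingEquiv⟩⟩
  by_contra! hlt
  refine (h1.trans (max_le_max h2 le_rfl)).not_gt ?_
  simp only [max_lt_iff]
  exact ⟨⟨⟨hA.trans_lt hS, hlt⟩, hS⟩, hS⟩

/-- For a pseudo strong limit cardinal `κ > ℵ₀` and a commutative integral
domain `S` of cardinality `κ`, there exist a subring `R` of `S` and a commutative ring `T`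
containing `S` as a subring (via an injective ring homomorphism) such that
`|R| = |T| = κ` and both `R` and `T` have a chain of prime ideals of cardinality `2 ^ κ`,
hence strong cardinal Krull dimension `2 ^ κ`. -/
theorem stmt16 (κ : Cardinal.{u}) (hκ : ℵ₀ < κ)
    (hpsl : ∀ α : Cardinal.{u}, α < κ → 2 ^ α ≤ κ)
    (S : Type u) [CommRing S] [IsDomain S] (hS : #S = κ) :
    ∃ (R : Subring S) (T : Type u) (_ : CommRing T) (f : S →+* T),
      Function.Injective f ∧ #R = κ ∧ #T = κ ∧
      (∃ C : Set (Ideal R), IsPrimeIdealChain C ∧ #C = 2 ^ κ) ∧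
      (∃ C : Set (Ideal T), IsPrimeIdealChain C ∧ #C = 2 ^ κ) ∧
      HasStrongCDim R (2 ^ κ) ∧ HasStrongCDim T (2 ^ κ) := by
  have hκ' := hκ.le
  obtain ⟨R, A, σ, _, _, hσ, ⟨e⟩⟩ := exists_subring_equiv_mvPolynomial S (hκ.trans_eq hS.symm)
  rw [hS] at hσ
  have hR : #R = κ := by
    refine le_antisymm (hS ▸ mk_subtype_le _) ?_
    rw [mk_congr e.toEquiv, ← hσ]
    exact mk_le_of_injective (MvPolynomial.X_injective (R := A))
  have : Nonempty S := ⟨0⟩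
  have hT : #(MvPolynomial S S) = κ := by
    rw [MvPolynomial.cardinalMk_eq_max, hS, max_self, max_eq_left hκ']
  have cR := exists_primeIdealChain_of_equiv hκ' hpsl hσ e
  have cT := exists_primeIdealChain_of_equiv hκ' hpsl hS (RingEquiv.refl (MvPolynomial S S))
  exact ⟨R, MvPolynomial S S, inferInstance, MvPolynomial.C, MvPolynomial.C_injective S S, hR, hT,
    cR, cT, hasStrongCDim_of_chain hκ' hR cR, hasStrongCDim_of_chain hκ' hT cT⟩
end
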